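/- arXiv:2002.00409 — 4 statements merged into one kernel-verified Lean document; each statement's English description precedes it below -/
import Mathlib

section
/- Let M be a proper metric space and let K₁ and K₂ be two compactifications with the same set X = K₁' = K₂' of isolated points. If K₁ and K₂ are both homeomorphic to subspaces of the product M^κ for some cardinal κ, then K₁ and K₂ are equivalent if and only if they are M-equivalent. -/
open Set Filter Topology

universe u u₁ u₂ v w

section CoarsePreamble

variable {X : Type u}

/-- An entourage on `X` is a subset of `X × X` containing the diagonal. -/
def IsEntourage (E : Set (X × X)) : Prop := ∀ x : X, (x, x) ∈ E

/-- Composition `E ∘ F` of two entourages. -/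
def entComp (E F : Set (X × X)) : Set (X × X) :=
  {p | ∃ y : X, (p.1, y) ∈ E ∧ (y, p.2) ∈ F}

/-- Inverse `E⁻¹` of an entourage. -/
def entInv (E : Set (X × X)) : Set (X × X) := {p | (p.2, p.1) ∈ E}

/-- The `E`-ball `E[x]` centered at `x`. -/
def entBall (E : Set (X × X)) (x : X) : Set X := {y | (x, y) ∈ E}

/-- A coarse structure on `X`: a family of entourages covering `X × X`, closed under
`E ∘ F⁻¹` up to enlargement, and downward closed among entourages. -/
structure IsCoarseStructure (𝓔 : Set (Set (X × X))) : Prop where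
  ent : ∀ E ∈ 𝓔, IsEntourage E
  cover : ∀ p : X × X, ∃ E ∈ 𝓔, p ∈ E
  comp_subset : ∀ E ∈ 𝓔, ∀ F ∈ 𝓔, ∃ G ∈ 𝓔, entComp E (entInv F) ⊆ G
  downward : ∀ E F : Set (X × X), IsEntourage E → E ⊆ F → F ∈ 𝓔 → E ∈ 𝓔

/-- A set `B` is bounded in the coarse space `(X, 𝓔)` if `B ⊆ E[x]` for some `E ∈ 𝓔`, `x ∈ X`. -/
def IsBoundedSet (𝓔 : Set (Set (X × X))) (B : Set X) : Prop :=
  ∃ E ∈ 𝓔, ∃ x : X, B ⊆ entBall E x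

/-- A coarse structure is finitary if the cardinalities of balls of each entourage
are uniformly finite. -/
def IsFinitaryCoarse (𝓔 : Set (Set (X × X))) : Prop :=
  ∀ E ∈ 𝓔, ∃ n : ℕ, ∀ x : X, (entBall E x).Finite ∧ (entBall E x).ncard ≤ n

/-- `d : X → X → ℝ` is a metric. -/
structure IsMetricOn (d : X → X → ℝ) : Prop where
  refl : ∀ x, d x x = 0
  eq_of : ∀ x y, d x y = 0 → x = y
  symm : ∀ x y, d x y = d y x
  triangle : ∀ x y z, d x z ≤ d x y + d y z

/-- A coarse structure is metrizable if it is the coarse structure of some metric on `X`,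
i.e. consists of all entourages of uniformly bounded `d`-diameter. -/
def IsMetrizableCoarse (𝓔 : Set (Set (X × X))) : Prop :=
  ∃ d : X → X → ℝ, IsMetricOn d ∧
    𝓔 = {E | IsEntourage E ∧ ∃ n : ℕ, ∀ p ∈ E, d p.1 p.2 ≤ (n : ℝ)}

/-- A cellular entourage: a symmetric and transitive entourage (an equivalence relation). -/
def IsCellularEnt (E : Set (X × X)) : Prop :=
  (∀ p : X × X, p ∈ E → (p.2, p.1) ∈ E) ∧
    ∀ x y z : X, (x, y) ∈ E → (y, z) ∈ E → (x, z) ∈ E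

/-- `𝓑` is a base of the coarse structure `𝓔`. -/
def IsCoarseBase (𝓔 𝓑 : Set (Set (X × X))) : Prop :=
  𝓑 ⊆ 𝓔 ∧ ∀ E ∈ 𝓔, ∃ B ∈ 𝓑, E ⊆ B

/-- A coarse structure is cellular if it has a base of cellular entourages. -/
def IsCellularCoarse (𝓔 : Set (Set (X × X))) : Prop :=
  ∃ 𝓑 : Set (Set (X × X)), IsCoarseBase 𝓔 𝓑 ∧ ∀ B ∈ 𝓑, IsCellularEnt B

/-- A subset `D` is `𝓔`-discrete (thin). -/
def IsCoarseDiscrete (𝓔 : Set (Set (X × X))) (D : Set X) : Prop :=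
  ∀ E ∈ 𝓔, ∃ B : Set X, IsBoundedSet 𝓔 B ∧ ∀ x ∈ D \ B, D ∩ entBall E x = {x}

/-- The basic entourage `E_F` determined by a set `F` of permutations of `X`. -/
def permEnt (F : Set (Equiv.Perm X)) : Set (X × X) :=
  {p | p.2 = p.1 ∨ ∃ g ∈ F, p.2 = g p.1}

/-- The coarse structure `𝓔_G` generated by a set (group) `S` of permutations of `X`:
all entourages contained in `E_F` for some finite `F ⊆ S`. -/
def permCoarse (S : Set (Equiv.Perm X)) : Set (Set (X × X)) :=
  {E | IsEntourage E ∧ ∃ F : Finset (Equiv.Perm X),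
    (F : Set (Equiv.Perm X)) ⊆ S ∧ E ⊆ permEnt (F : Set (Equiv.Perm X))}

variable {M : Type v} [MetricSpace M]

/-- A function `φ : X → M` is slowly oscillating. -/
def SlowlyOscillating (𝓔 : Set (Set (X × X))) (φ : X → M) : Prop :=
  ∀ ε : ℝ, 0 < ε → ∀ E ∈ 𝓔, ∃ B : Set X, IsBoundedSet 𝓔 B ∧
    ∀ x : X, x ∉ B → EMetric.diam (φ '' entBall E x) < ENNReal.ofReal ε

/-- Two sets are asymptotically separated if `E[A] ∩ E[B]` is bounded for every `E ∈ 𝓔`. -/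
def AsymptoticallySeparated (𝓔 : Set (Set (X × X))) (A B : Set X) : Prop :=
  ∀ E ∈ 𝓔, IsBoundedSet 𝓔 ((⋃ a ∈ A, entBall E a) ∩ ⋃ b ∈ B, entBall E b)

/-- A coarse space `(X, 𝓔)` is `M`-normal. -/
def IsCoarseNormal (𝓔 : Set (Set (X × X))) (M : Type v) [MetricSpace M] : Prop :=
  ∀ A B : Set X, A.Nonempty → B.Nonempty → Disjoint A B →
    AsymptoticallySeparated 𝓔 A B →
    ∃ φ : X → M, SlowlyOscillating 𝓔 φ ∧
      ∃ ε : ℝ, 0 < ε ∧ ∀ a ∈ A, ∀ b ∈ B, ε ≤ dist (φ a) (φ b)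

/-- `so(X,𝓔;M)`: the bounded slowly oscillating functions `X → M`. -/
def soSet (𝓔 : Set (Set (X × X))) (M : Type v) [MetricSpace M] : Set (X → M) :=
  {φ | Bornology.IsBounded (Set.range φ) ∧ SlowlyOscillating 𝓔 φ}

/-- The canonical map `δ_M : X → M^{so(X,𝓔;M)}`. -/
def deltaMap (𝓔 : Set (Set (X × X))) (M : Type v) [MetricSpace M] :
    X → (↥(soSet 𝓔 M) → M) := fun x f => f.1 x

/-- The underlying set of the `M`-compactification: the closure of `δ_M(X)`. -/
def hCompSet (𝓔 : Set (Set (X × X))) (M : Type v) [MetricSpace M] :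
    Set (↥(soSet 𝓔 M) → M) := closure (Set.range (deltaMap 𝓔 M))

/-- The `M`-compactification `h_M(X,𝓔)` of the coarse space `(X,𝓔)`. -/
abbrev HComp (𝓔 : Set (Set (X × X))) (M : Type v) [MetricSpace M] :=
  ↥(hCompSet 𝓔 M)

/-- The copy of a point `x ∈ X` inside the `M`-compactification. -/
def deltaEmb (𝓔 : Set (Set (X × X))) (M : Type v) [MetricSpace M] (x : X) :
    HComp 𝓔 M := ⟨deltaMap 𝓔 M x, subset_closure (Set.mem_range_self x)⟩

/-- The permutation group `G_{X, h_M(X,𝓔)}` of the `M`-compactification, as a set of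
permutations of `X` (`X` being identified with the set of isolated points of `h_M(X,𝓔)`
via `δ_M`): those permutations induced by homeomorphisms of `h_M(X,𝓔)` fixing all
points outside (the image of) `X`. -/
def hPermGroup (𝓔 : Set (Set (X × X))) (M : Type v) [MetricSpace M] :
    Set (Equiv.Perm X) :=
  {σ | ∃ h : HComp 𝓔 M ≃ₜ HComp 𝓔 M,
    (∀ z : HComp 𝓔 M, z ∉ Set.range (deltaEmb 𝓔 M) → h z = z) ∧
    ∀ x : X, h (deltaEmb 𝓔 M x) = deltaEmb 𝓔 M (σ x)}

end CoarsePreamble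

section TopPreamble

/-- The set of isolated points of a topological space. -/
def isolatedPoints (K : Type w) [TopologicalSpace K] : Set K :=
  {x | IsOpen ({x} : Set K)}

/-- A compactification: a compact Hausdorff space with dense set of isolated points. -/
def IsCompactification (K : Type w) [TopologicalSpace K] : Prop :=
  CompactSpace K ∧ T2Space K ∧ Dense (isolatedPoints K)

/-- The permutation group `G_{K',K}` of a compactification `K`: permutations of the
set `K'` of isolated points induced by homeomorphisms of `K` fixing `K \ K'` pointwise. -/
def homeoPerms (K : Type w) [TopologicalSpace K] :
    Set (Equiv.Perm ↥(isolatedPoints K)) :=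
  {σ | ∃ h : K ≃ₜ K, (∀ z : K, z ∉ isolatedPoints K → h z = z) ∧
    ∀ x : ↥(isolatedPoints K), h x.val = (σ x).val}

/-- The oscillation of `φ : K' → M` at a point `z ∈ K`. -/
noncomputable def oscAt {K : Type w} [TopologicalSpace K] {M : Type v} [MetricSpace M]
    (φ : ↥(isolatedPoints K) → M) (z : K) : ENNReal :=
  ⨅ (O : Set K) (_ : IsOpen O) (_ : z ∈ O),
    EMetric.diam (φ '' (Subtype.val ⁻¹' O))

/-- A compactification `K` is `M`-soft. -/
def IsMSoft (K : Type w) [TopologicalSpace K] (M : Type v) [MetricSpace M] : Prop :=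
  ∀ φ : ↥(isolatedPoints K) → M, Bornology.IsBounded (Set.range φ) →
    (∃ z : K, 0 < oscAt φ z) →
    ∃ σ ∈ homeoPerms K, ∃ ε : ℝ, 0 < ε ∧
      {x : ↥(isolatedPoints K) | ε ≤ dist (φ (σ x)) (φ x)}.Infinite

/-- A compactification `K` is soft. -/
def IsSoft (K : Type w) [TopologicalSpace K] : Prop :=
  ∀ A B : Set ↥(isolatedPoints K), Disjoint A B →
    (closure (Subtype.val '' A) ∩ closure (Subtype.val '' B)).Nonempty →
    ∃ σ ∈ homeoPerms K, {x : ↥(isolatedPoints K) | x ∈ A ∧ σ x ∈ B}.Infinite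

/-- `uc(K',K;M)`: restrictions to the set of isolated points of continuous functions `K → M`. -/
def ucSet (K : Type w) [TopologicalSpace K] (M : Type v) [MetricSpace M] :
    Set (↥(isolatedPoints K) → M) :=
  {φ | ∃ f : K → M, Continuous f ∧ ∀ x : ↥(isolatedPoints K), f x.val = φ x}

/-- `uc(X, h_M(X,𝓔); M)`: restrictions to `X` (via `δ_M`) of continuous functions
`h_M(X,𝓔) → M`. -/
def ucHComp {X : Type u} (𝓔 : Set (Set (X × X))) (M : Type v) [MetricSpace M] :
    Set (X → M) :=
  {φ | ∃ f : HComp 𝓔 M → M, Continuous f ∧ ∀ x : X, f (deltaEmb 𝓔 M x) = φ x}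

/-- The cardinal `Δ`: the smallest cardinality of a base of a cellular finitary coarse
structure on `ω` containing no infinite discrete subsets. -/
noncomputable def smallDeltaCard : Cardinal.{0} :=
  sInf {c : Cardinal.{0} | ∃ 𝓔 : Set (Set (ℕ × ℕ)), IsCoarseStructure 𝓔 ∧
    IsCellularCoarse 𝓔 ∧ IsFinitaryCoarse 𝓔 ∧
    (∀ D : Set ℕ, IsCoarseDiscrete 𝓔 D → D.Finite) ∧
    ∃ 𝓑 : Set (Set (ℕ × ℕ)), IsCoarseBase 𝓔 𝓑 ∧ Cardinal.mk ↥𝓑 = c}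

/-- The cardinal `𝔭`. -/
noncomputable def pCard : Cardinal.{0} :=
  sInf {c : Cardinal.{0} | ∃ F : Set (Set ℕ), (∀ A ∈ F, A.Infinite) ∧
    (∀ S : Finset (Set ℕ), (S : Set (Set ℕ)) ⊆ F → (⋂ A ∈ S, A).Infinite) ∧
    (∀ I : Set ℕ, I.Infinite → ∃ A ∈ F, (I \ A).Infinite) ∧
    Cardinal.mk ↥F = c}

/-- The character `χ(x;K)` of a point. -/
noncomputable def charAt (K : Type w) [TopologicalSpace K] (x : K) : Cardinal.{w} :=
  sInf {c : Cardinal.{w} | ∃ 𝓑 : Set (Set K), (∀ U ∈ 𝓑, IsOpen U ∧ x ∈ U) ∧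
    (∀ V : Set K, IsOpen V → x ∈ V → ∃ U ∈ 𝓑, U ⊆ V) ∧ Cardinal.mk ↥𝓑 = c}

/-- The character `χ(K)` of a space. -/
noncomputable def spaceChar (K : Type w) [TopologicalSpace K] : Cardinal.{w} :=
  ⨆ x : K, charAt K x

/-- A corona: a compact Hausdorff space homeomorphic to the remainder of a
compactification of the countable discrete space `ℕ`. -/
def IsCorona (K : Type w) [TopologicalSpace K] : Prop :=
  CompactSpace K ∧ T2Space K ∧
    ∃ (C : Type w) (_ : TopologicalSpace C), IsCompactification C ∧
      (isolatedPoints C).Infinite ∧ (isolatedPoints C).Countable ∧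
      Nonempty (K ≃ₜ ↥((isolatedPoints C)ᶜ))

/-- A soft corona. -/
def IsSoftCorona (K : Type w) [TopologicalSpace K] : Prop :=
  CompactSpace K ∧ T2Space K ∧
    ∃ (C : Type w) (_ : TopologicalSpace C), IsCompactification C ∧ IsSoft C ∧
      (isolatedPoints C).Infinite ∧ (isolatedPoints C).Countable ∧
      Nonempty (K ≃ₜ ↥((isolatedPoints C)ᶜ))

/-- An `M`-soft corona. -/
def IsMSoftCorona (K : Type w) [TopologicalSpace K] (M : Type v) [MetricSpace M] : Prop :=
  CompactSpace K ∧ T2Space K ∧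
    ∃ (C : Type w) (_ : TopologicalSpace C), IsCompactification C ∧ IsMSoft C M ∧
      (isolatedPoints C).Infinite ∧ (isolatedPoints C).Countable ∧
      Nonempty (K ≃ₜ ↥((isolatedPoints C)ᶜ))

end TopPreamble


/-- If `L` is compact and embeds into a power of a Hausdorff space `M`, and every continuous map
`L → M`, restricted along `j`, extends along the dense map `i : X → K`, then `j` itself extends
to a continuous map `K → L`. -/
theorem exists_continuous_extension_of_isEmbedding_pi {X K L M ι : Type*}
    [TopologicalSpace K] [TopologicalSpace L] [CompactSpace L] [TopologicalSpace M] [T2Space M]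
    {i : X → K} (hi : DenseRange i) {j : X → L} {e : L → ι → M} (he : IsEmbedding e)
    (hext : ∀ f : L → M, Continuous f → ∃ g : K → M, Continuous g ∧ ∀ x, g (i x) = f (j x)) :
    ∃ g : K → L, Continuous g ∧ ∀ x, g (i x) = j x := by
  choose F hFc hF using fun k => hext (fun y => e y k) ((continuous_apply k).comp he.continuous)
  have hGc : Continuous fun z k => F k z := continuous_pi hFc
  have hG : ∀ x, (fun k => F k (i x)) = e (j x) := fun x => funext fun k => hF k x
  have hmem : ∀ z, (fun k => F k z) ∈ range e := fun z =>
    hi.induction_on (p := fun z => (fun k => F k z) ∈ range e) z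
      ((isCompact_range he.continuous).isClosed.preimage hGc) fun x => ⟨j x, (hG x).symm⟩
  choose g hg using hmem
  refine ⟨g, he.continuous_iff.2 ?_, fun x => he.injective ((hg _).trans (hG x))⟩
  exact hGc.congr fun z => (hg z).symm

/-- For a proper metric space `M` and two compactifications `K₁`, `K₂`
with the same set `X` of isolated points (identified via `i₁`, `i₂`), if both embed
into a power `M^ι`, then `K₁` and `K₂` are equivalent iff they are `M`-equivalent. -/
theorem statement0 {X : Type u} {K₁ : Type u₁} {K₂ : Type u₂}
    [TopologicalSpace K₁] [TopologicalSpace K₂]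
    (M : Type v) [MetricSpace M] [ProperSpace M] [Nontrivial M]
    (hK₁ : IsCompactification K₁) (hK₂ : IsCompactification K₂)
    (i₁ : X → K₁) (i₂ : X → K₂)
    (hi₁ : Function.Injective i₁) (hi₂ : Function.Injective i₂)
    (hr₁ : Set.range i₁ = isolatedPoints K₁) (hr₂ : Set.range i₂ = isolatedPoints K₂)
    {ι : Type w} (e₁ : K₁ → ι → M) (e₂ : K₂ → ι → M)
    (he₁ : Topology.IsEmbedding e₁) (he₂ : Topology.IsEmbedding e₂) :
    (∃ h : K₁ ≃ₜ K₂, ∀ x : X, h (i₁ x) = i₂ x) ↔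
      {φ : X → M | ∃ f : K₁ → M, Continuous f ∧ ∀ x : X, f (i₁ x) = φ x} =
        {φ : X → M | ∃ f : K₂ → M, Continuous f ∧ ∀ x : X, f (i₂ x) = φ x} := by
  obtain ⟨_, _, hd₁⟩ := hK₁
  obtain ⟨_, _, hd₂⟩ := hK₂
  rw [← hr₁] at hd₁
  rw [← hr₂] at hd₂
  constructor
  · rintro ⟨h, hh⟩
    ext φ
    constructor
    · rintro ⟨f, hf, hφ⟩
      exact ⟨f ∘ h.symm, hf.comp h.symm.continuous, fun x => by simp [← hh, hφ]⟩
    · rintro ⟨f, hf, hφ⟩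
      exact ⟨f ∘ h, hf.comp h.continuous, fun x => by simp [hh, hφ]⟩
  · intro h
    obtain ⟨g, hg, hgi⟩ := exists_continuous_extension_of_isEmbedding_pi hd₁ (j := i₂) he₂
      fun f hf => h.ge ⟨f, hf, fun _ => rfl⟩
    obtain ⟨k, hk, hki⟩ := exists_continuous_extension_of_isEmbedding_pi hd₂ (j := i₁) he₁
      fun f hf => h.le ⟨f, hf, fun _ => rfl⟩
    have hkg : k ∘ g = id := DenseRange.equalizer hd₁ (hk.comp hg) continuous_id
      (funext fun x => by simp [hgi, hki])
    have hgk : g ∘ k = id := DenseRange.equalizer hd₂ (hg.comp hk) continuous_id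
      (funext fun x => by simp [hgi, hki])
    exact ⟨⟨⟨g, k, congr_fun hkg, congr_fun hgk⟩, hg, hk⟩, hgi⟩
end

section
/- Let M be a proper metric space. Assume Δ = 𝔠, where Δ is the smallest cardinality of a base of a cellular finitary coarse structure on ω containing no infinite discrete subsets. Then each separable M-soft compactification K is M-equivalent to the M-compactification h_M(K',𝓔) of the set K' of isolated points of K endowed with a suitable cellular finitary coarse structure 𝓔. -/
open Set Filter Topology

universe u u₁ u₂ v w

namespace CellularCoarse

/-- The classes of the equivalence relation are finite and of uniformly bounded size. -/
def FinitarySetoid {X : Type u} (E : Setoid X) : Prop :=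
  ∃ n : ℕ, ∀ x, {y | E x y}.Finite ∧ {y | E x y}.ncard ≤ n

/-- A function is slowly oscillating along an equivalence relation, finite sets being the
bounded ones. -/
def SlowAlong {X : Type u} {M : Type v} [MetricSpace M] (E : Setoid X) (φ : X → M) : Prop :=
  ∀ ε : ℝ, 0 < ε → {x | ∃ y, E x y ∧ ε ≤ dist (φ x) (φ y)}.Finite

/-- The equivalence relation is finitary and all functions in `U` are slowly oscillating
along it. -/
def Admissible {X : Type u} {M : Type v} [MetricSpace M] (U : Set (X → M)) (E : Setoid X) :
    Prop :=
  FinitarySetoid E ∧ ∀ f ∈ U, SlowAlong E f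

section Setoids

variable {X : Type u} {M : Type v} [MetricSpace M]

lemma FinitarySetoid.mono {E F : Setoid X} (h : E ≤ F) (hF : FinitarySetoid F) :
    FinitarySetoid E := by
  obtain ⟨n, hn⟩ := hF
  refine ⟨n, fun x => ?_⟩
  have hs : {y | E x y} ⊆ {y | F x y} := fun y hy => h hy
  exact ⟨(hn x).1.subset hs, (Set.ncard_le_ncard hs (hn x).1).trans (hn x).2⟩

lemma SlowAlong.mono {E F : Setoid X} {φ : X → M} (h : E ≤ F) (hF : SlowAlong F φ) :
    SlowAlong E φ := fun ε hε =>
  (hF ε hε).subset fun _ ⟨y, hy, hd⟩ => ⟨y, h hy, hd⟩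

lemma Admissible.mono {U : Set (X → M)} {E F : Setoid X} (h : E ≤ F) (hF : Admissible U F) :
    Admissible U E :=
  ⟨hF.1.mono h, fun f hf => (hF.2 f hf).mono h⟩

/-- Saturated sets for two equivalence relations are saturated for their join. -/
lemma mem_of_sup {E P : Setoid X} {T : Set X} (hE : ∀ x y, E x y → x ∈ T → y ∈ T)
    (hP : ∀ x y, P x y → x ∈ T → y ∈ T) {x y : X} (h : (E ⊔ P) x y) (hx : x ∈ T) : y ∈ T := by
  have key : E ⊔ P ≤ Setoid.ker (· ∈ T) := by
    refine sup_le (fun a b hab => ?_) (fun a b hab => ?_)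
    · exact propext ⟨hE a b hab, hE b a (E.symm hab)⟩
    · exact propext ⟨hP a b hab, hP b a (P.symm hab)⟩
  have := key h
  have h2 : (x ∈ T) = (y ∈ T) := this
  exact h2 ▸ hx

open Classical in
/-- The equivalence relation whose nontrivial classes are the pairs `{j n, k n}`. -/
noncomputable def pairSetoid (j k : ℕ → X) : Setoid X :=
  Setoid.ker fun x => if h : ∃ n, k n = x then j h.choose else x

open Classical in
lemma pairSetoid_rel {j k : ℕ → X} (hk : Function.Injective k) (hjk : ∀ n m, j n ≠ k m) (n : ℕ) :
    pairSetoid j k (j n) (k n) := by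
  have h1 : ¬ ∃ m, k m = j n := fun ⟨m, hm⟩ => hjk n m hm.symm
  have h2 : ∃ m, k m = k n := ⟨n, rfl⟩
  have h3 : h2.choose = n := hk h2.choose_spec
  change (if h : ∃ m, k m = j n then j h.choose else j n) =
    (if h : ∃ m, k m = k n then j h.choose else k n)
  rw [dif_neg h1, dif_pos h2, h3]

open Classical in
lemma pairSetoid_cases {j k : ℕ → X} (hj : Function.Injective j) {x y : X}
    (h : pairSetoid j k x y) :
    x = y ∨ ∃ n, (x = j n ∨ x = k n) ∧ (y = j n ∨ y = k n) := by
  change (if h : ∃ m, k m = x then j h.choose else x) =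
    (if h : ∃ m, k m = y then j h.choose else y) at h
  by_cases hx : ∃ m, k m = x <;> by_cases hy : ∃ m, k m = y
  · rw [dif_pos hx, dif_pos hy] at h
    have := hj h
    exact Or.inr ⟨hx.choose, Or.inr hx.choose_spec.symm, Or.inr (this ▸ hy.choose_spec.symm)⟩
  · rw [dif_pos hx, dif_neg hy] at h
    exact Or.inr ⟨hx.choose, Or.inr hx.choose_spec.symm, Or.inl h.symm⟩
  · rw [dif_neg hx, dif_pos hy] at h
    exact Or.inr ⟨hy.choose, Or.inl h, Or.inr hy.choose_spec.symm⟩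
  · rw [dif_neg hx, dif_neg hy] at h
    exact Or.inl h

/-- Joining a finitary equivalence relation with a sequence of pairs that are almost
separated from each other preserves admissibility. -/
lemma admissible_sup_pairSetoid {U : Set (X → M)} {E : Setoid X} {j k : ℕ → X}
    (hj : Function.Injective j) (hk : Function.Injective k) (hE : Admissible U E)
    (hU : ∀ f ∈ U, ∀ ε : ℝ, 0 < ε → {n | ε ≤ dist (f (j n)) (f (k n))}.Finite)
    (hjj : {n | ∃ m, m ≠ n ∧ E (j n) (j m)}.Finite)
    (hkk : {n | ∃ m, m ≠ n ∧ E (k n) (k m)}.Finite)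
    (hjk : {n | ∃ m, E (j n) (k m)}.Finite)
    (hkj : {n | ∃ m, E (k n) (j m)}.Finite) :
    Admissible U (E ⊔ pairSetoid j k) := by
  set C : ℕ → Set X := fun n => {y | E (j n) y} ∪ {y | E (k n) y} with hC
  obtain ⟨c, hc⟩ := hE.1
  have hCfin : ∀ n, (C n).Finite := fun n => (hc _).1.union (hc _).1
  have hCcard : ∀ n, (C n).ncard ≤ 2 * c := fun n => by
    have h1 := (hc (j n)).2
    have h2 := (hc (k n)).2
    have h3 := Set.ncard_union_le {y | E (j n) y} {y | E (k n) y}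
    simp only [hC]
    omega
  set N : Set ℕ := {n | ∃ m, m ≠ n ∧ E (j n) (j m)} ∪ {n | ∃ m, m ≠ n ∧ E (k n) (k m)} ∪
    {n | ∃ m, E (j n) (k m)} ∪ {n | ∃ m, E (k n) (j m)} with hN
  have hNfin : N.Finite := ((hjj.union hkk).union hjk).union hkj
  set S : Set X := ⋃ n ∈ N, C n with hS
  have hSfin : S.Finite := hNfin.biUnion fun n _ => hCfin n
  have hjC : ∀ n, j n ∈ C n := fun n => Or.inl (E.refl _)
  have hkC : ∀ n, k n ∈ C n := fun n => Or.inr (E.refl _)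
  have hCE : ∀ n x y, E x y → x ∈ C n → y ∈ C n := by
    rintro n x y hxy (hx | hx)
    · exact Or.inl (E.trans hx hxy)
    · exact Or.inr (E.trans hx hxy)
  have hmeet : ∀ n m, n ∉ N → (j m ∈ C n ∨ k m ∈ C n) → m = n := by
    intro n m hn hm
    by_contra hne
    apply hn
    rcases hm with (h | h) | (h | h)
    · exact Or.inl (Or.inl (Or.inl ⟨m, hne, h⟩))
    · exact Or.inr ⟨m, h⟩
    · exact Or.inl (Or.inr ⟨m, h⟩)
    · exact Or.inl (Or.inl (Or.inr ⟨m, hne, h⟩))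
  have hback : ∀ n m, (j n ∈ C m ∨ k n ∈ C m) → (j m ∈ C n ∨ k m ∈ C n) := by
    rintro n m ((h | h) | (h | h))
    · exact Or.inl (Or.inl (E.symm h))
    · exact Or.inr (Or.inl (E.symm h))
    · exact Or.inl (Or.inr (E.symm h))
    · exact Or.inr (Or.inr (E.symm h))
  have hpair : ∀ n y, (y = j n ∨ y = k n) → y ∈ C n := by
    rintro n y (rfl | rfl)
    exacts [hjC n, hkC n]
  have hSsat : ∀ x y, (E ⊔ pairSetoid j k) x y → x ∈ S → y ∈ S := by
    refine fun x y h hx => mem_of_sup ?_ ?_ h hx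
    · intro x y hxy hx
      simp only [hS, Set.mem_iUnion] at hx ⊢
      obtain ⟨n, hn, hx⟩ := hx
      exact ⟨n, hn, hCE n x y hxy hx⟩
    · intro x y hxy hx
      rcases pairSetoid_cases hj hxy with rfl | ⟨n, hxn, hyn⟩
      · exact hx
      simp only [hS, Set.mem_iUnion] at hx ⊢
      obtain ⟨m, hm, hx⟩ := hx
      by_cases hn : n ∈ N
      · exact ⟨n, hn, hpair n y hyn⟩
      · have : m = n := hmeet n m hn (hback n m (by
          rcases hxn with rfl | rfl
          exacts [Or.inl hx, Or.inr hx]))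
        exact absurd (this ▸ hm) hn
  have hCsat : ∀ n, n ∉ N → ∀ x y, (E ⊔ pairSetoid j k) x y → x ∈ C n → y ∈ C n := by
    refine fun n hn x y h hx => mem_of_sup (hCE n) ?_ h hx
    intro x y hxy hx
    rcases pairSetoid_cases hj hxy with rfl | ⟨m, hxm, hym⟩
    · exact hx
    · have : m = n := hmeet n m hn (by
        rcases hxm with rfl | rfl
        exacts [Or.inl hx, Or.inr hx])
      exact this ▸ hpair m y hym
  have hEsat : ∀ x, (∀ n, x ∉ C n) → ∀ y, (E ⊔ pairSetoid j k) x y → E x y := by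
    intro x hx y h
    refine mem_of_sup (T := {y | E x y}) (fun a b hab ha => E.trans ha hab) ?_ h (E.refl x)
    intro a b hab ha
    rcases pairSetoid_cases hj hab with rfl | ⟨m, ham, -⟩
    · exact ha
    · exact absurd (hCE m a x (E.symm ha) (hpair m a ham)) (hx m)
  refine ⟨⟨S.ncard + 2 * c, fun x => ?_⟩, fun f hf ε hε => ?_⟩
  · have aux : ∀ T : Set X, T.Finite → T.ncard ≤ S.ncard + 2 * c →
        (∀ y, (E ⊔ pairSetoid j k) x y → y ∈ T) →
        {y | (E ⊔ pairSetoid j k) x y}.Finite ∧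
          {y | (E ⊔ pairSetoid j k) x y}.ncard ≤ S.ncard + 2 * c :=
      fun T hT hcard hsub => ⟨hT.subset hsub, (Set.ncard_le_ncard hsub hT).trans hcard⟩
    by_cases hxS : x ∈ S
    · exact aux S hSfin (by omega) fun y hy => hSsat x y hy hxS
    by_cases hxC : ∃ n, x ∈ C n
    · obtain ⟨n, hn⟩ := hxC
      have hnN : n ∉ N := fun h => hxS (Set.mem_biUnion h hn)
      exact aux (C n) (hCfin n) (by have := hCcard n; omega) fun y hy => hCsat n hnN x y hy hn
    · push Not at hxC
      exact aux {y | E x y} (hc x).1 (by have := (hc x).2; omega) (hEsat x hxC)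
  · have hε3 : 0 < ε / 3 := by positivity
    set B := {x | ∃ y, E x y ∧ ε / 3 ≤ dist (f x) (f y)} with hB
    have hBfin : B.Finite := hE.2 f hf _ hε3
    set N' : Set ℕ := {n | ε / 3 ≤ dist (f (j n)) (f (k n))} ∪ j ⁻¹' B ∪ k ⁻¹' B with hN'
    have hN'fin : N'.Finite :=
      ((hU f hf _ hε3).union (hBfin.preimage hj.injOn)).union (hBfin.preimage hk.injOn)
    have hfin : (B ∪ S ∪ ⋃ n ∈ N', C n).Finite :=
      (hBfin.union hSfin).union (hN'fin.biUnion fun n _ => hCfin n)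
    refine hfin.subset ?_
    rintro x ⟨y, hxy, hd⟩
    by_contra hx
    simp only [Set.mem_union, not_or] at hx
    obtain ⟨⟨hxB, hxS⟩, hxN⟩ := hx
    have near : ∀ a b, a ∉ B → E a b → dist (f a) (f b) < ε / 3 := by
      intro a b ha hab
      by_contra hlt
      exact ha ⟨b, hab, not_lt.mp hlt⟩
    by_cases hxC : ∃ n, x ∈ C n
    · obtain ⟨n, hn⟩ := hxC
      have hnN : n ∉ N := fun h => hxS (Set.mem_biUnion h hn)
      have hnN' : n ∉ N' := fun h => hxN (Set.mem_biUnion h hn)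
      have hy := hCsat n hnN x y hxy hn
      simp only [hN', Set.mem_union, not_or, Set.mem_ofPred_eq, Set.mem_preimage, not_le] at hnN'
      obtain ⟨⟨h1, h2⟩, h3⟩ := hnN'
      rcases hn with hn | hn <;> rcases hy with hy | hy
      · have a := near _ _ h2 hn
        have b := near _ _ h2 hy
        have := dist_triangle_left (f x) (f y) (f (j n))
        linarith
      · have a := near _ _ h2 hn
        have b := near _ _ h3 hy
        have := dist_triangle4_left (f (j n)) (f (k n)) (f x) (f y)
        linarith
      · have a := near _ _ h3 hn
        have b := near _ _ h2 hy
        have := dist_triangle4_left (f (k n)) (f (j n)) (f x) (f y)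
        rw [dist_comm (f (k n)) (f (j n))] at this
        linarith
      · have a := near _ _ h3 hn
        have b := near _ _ h3 hy
        have := dist_triangle_left (f x) (f y) (f (k n))
        linarith
    · push Not at hxC
      have := near x y hxB (hEsat x hxC y hxy)
      linarith

end Setoids

section Generated

variable {X : Type u} {κ : Type w}

/-- The coarse structure generated by a directed family of equivalence relations. -/
def genCoarse (E : κ → Setoid X) : Set (Set (X × X)) :=
  {A | IsEntourage A ∧ ∃ k, ∀ p ∈ A, E k p.1 p.2}

lemma graph_mem_genCoarse (E : κ → Setoid X) (k : κ) :
    {p : X × X | E k p.1 p.2} ∈ genCoarse E :=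
  ⟨fun x => (E k).refl x, k, fun _ hp => hp⟩

lemma isCoarseStructure_genCoarse {E : κ → Setoid X} (hdir : Directed (· ≤ ·) E)
    (hcov : ∀ x y, ∃ k, E k x y) : IsCoarseStructure (genCoarse E) where
  ent _ hE := hE.1
  cover p := by
    obtain ⟨k, hk⟩ := hcov p.1 p.2
    exact ⟨_, graph_mem_genCoarse E k, hk⟩
  comp_subset := by
    rintro A ⟨-, k, hk⟩ B ⟨-, l, hl⟩
    obtain ⟨m, hkm, hlm⟩ := hdir k l
    refine ⟨_, graph_mem_genCoarse E m, ?_⟩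
    rintro p ⟨y, h1, h2⟩
    have h3 := hk _ h1
    have h4 := hl _ h2
    exact (E m).trans (hkm h3) ((E m).symm (hlm h4))
  downward := fun A F hA hAF ⟨_, k, hk⟩ => ⟨hA, k, fun p hp => hk p (hAF hp)⟩

lemma isCoarseBase_genCoarse (E : κ → Setoid X) :
    IsCoarseBase (genCoarse E) (Set.range fun k => {p : X × X | E k p.1 p.2}) := by
  refine ⟨?_, ?_⟩
  · rintro _ ⟨k, rfl⟩
    exact graph_mem_genCoarse E k
  · rintro A ⟨-, k, hk⟩
    exact ⟨_, ⟨k, rfl⟩, hk⟩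

lemma isCellularCoarse_genCoarse (E : κ → Setoid X) : IsCellularCoarse (genCoarse E) := by
  refine ⟨_, isCoarseBase_genCoarse E, ?_⟩
  rintro _ ⟨k, rfl⟩
  exact ⟨fun p hp => (E k).symm hp, fun x y z hxy hyz => (E k).trans hxy hyz⟩

lemma isFinitaryCoarse_genCoarse {E : κ → Setoid X} (hfin : ∀ k, FinitarySetoid (E k)) :
    IsFinitaryCoarse (genCoarse E) := by
  rintro A ⟨-, k, hk⟩
  obtain ⟨n, hn⟩ := hfin k
  refine ⟨n, fun x => ?_⟩
  have hs : entBall A x ⊆ {y | E k x y} := fun y hy => hk _ hy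
  exact ⟨(hn x).1.subset hs, (Set.ncard_le_ncard hs (hn x).1).trans (hn x).2⟩

lemma isBoundedSet_genCoarse_iff [Nonempty X] {E : κ → Setoid X} (hdir : Directed (· ≤ ·) E)
    (hcov : ∀ x y, ∃ k, E k x y) (hfin : ∀ k, FinitarySetoid (E k)) (B : Set X) :
    IsBoundedSet (genCoarse E) B ↔ B.Finite := by
  constructor
  · rintro ⟨A, hA, x, hB⟩
    obtain ⟨n, hn⟩ := isFinitaryCoarse_genCoarse hfin A hA
    exact (hn x).1.subset hB
  · intro hB
    obtain ⟨x⟩ := ‹Nonempty X›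
    have : ∃ k, ∀ y ∈ B, E k x y := by
      induction B, hB using Set.Finite.induction_on with
      | empty =>
        obtain ⟨k, -⟩ := hcov x x
        exact ⟨k, by simp⟩
      | @insert a s _ _ ih =>
        obtain ⟨k, hk⟩ := ih
        obtain ⟨l, hl⟩ := hcov x a
        obtain ⟨m, hkm, hlm⟩ := hdir k l
        refine ⟨m, ?_⟩
        rintro y (rfl | hy)
        · exact hlm hl
        · exact hkm (hk y hy)
    obtain ⟨k, hk⟩ := this
    exact ⟨_, graph_mem_genCoarse E k, x, hk⟩

lemma slowlyOscillating_genCoarse_iff {M : Type v} [MetricSpace M] [Nonempty X]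
    {E : κ → Setoid X} (hdir : Directed (· ≤ ·) E)
    (hcov : ∀ x y, ∃ k, E k x y) (hfin : ∀ k, FinitarySetoid (E k)) (φ : X → M) :
    SlowlyOscillating (genCoarse E) φ ↔ ∀ k, SlowAlong (E k) φ := by
  constructor
  · intro h k ε hε
    obtain ⟨B, hB, hφ⟩ := h ε hε _ (graph_mem_genCoarse E k)
    rw [isBoundedSet_genCoarse_iff hdir hcov hfin] at hB
    refine hB.subset ?_
    rintro x ⟨y, hxy, hd⟩
    by_contra hx
    have h1 := (Metric.edist_le_ediam_of_mem (s := φ '' entBall {p : X × X | E k p.1 p.2} x)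
      (Set.mem_image_of_mem φ ((E k).refl x)) (Set.mem_image_of_mem φ hxy)).trans_lt (hφ x hx)
    rw [edist_dist, ENNReal.ofReal_lt_ofReal_iff hε] at h1
    linarith
  · rintro h ε hε A ⟨-, k, hk⟩
    have hε3 : 0 < ε / 3 := by positivity
    refine ⟨_, (isBoundedSet_genCoarse_iff hdir hcov hfin _).2 (h k _ hε3), fun x hx => ?_⟩
    have near : ∀ y ∈ entBall A x, dist (φ x) (φ y) < ε / 3 := fun y hy => by
      by_contra hlt
      exact hx ⟨y, hk _ hy, not_lt.mp hlt⟩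
    refine lt_of_le_of_lt (Metric.ediam_le (d := ENNReal.ofReal (2 * (ε / 3))) ?_)
      ((ENNReal.ofReal_lt_ofReal_iff hε).2 (by linarith))
    rintro _ ⟨y, hy, rfl⟩ _ ⟨z, hz, rfl⟩
    rw [edist_dist]
    refine ENNReal.ofReal_le_ofReal ?_
    have := near y hy
    have := near z hz
    have := dist_triangle_left (φ y) (φ z) (φ x)
    linarith

end Generated

/-- A directed family of fewer than `Δ` finitary equivalence relations on `ℕ` admits an
infinite discrete set. -/
lemma exists_infinite_discrete {κ : Type} (E : κ → Setoid ℕ) (hdir : Directed (· ≤ ·) E)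
    (hcov : ∀ x y, ∃ k, E k x y) (hfin : ∀ k, FinitarySetoid (E k))
    (hκ : Cardinal.mk κ < smallDeltaCard) :
    ∃ D : Set ℕ, D.Infinite ∧ ∀ k, {x ∈ D | ∃ y ∈ D, y ≠ x ∧ E k x y}.Finite := by
  have hnot : ¬ ∀ D : Set ℕ, IsCoarseDiscrete (genCoarse E) D → D.Finite := by
    intro hall
    have hle : smallDeltaCard ≤
        Cardinal.mk (Set.range fun k => {p : ℕ × ℕ | E k p.1 p.2}) :=
      csInf_le' ⟨genCoarse E, isCoarseStructure_genCoarse hdir hcov,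
        isCellularCoarse_genCoarse E, isFinitaryCoarse_genCoarse hfin, hall, _,
        isCoarseBase_genCoarse E, rfl⟩
    exact absurd (hle.trans Cardinal.mk_range_le) (not_le.2 hκ)
  push Not at hnot
  obtain ⟨D, hD, hinf⟩ := hnot
  refine ⟨D, hinf, fun k => ?_⟩
  obtain ⟨B, hB, hBD⟩ := hD _ (graph_mem_genCoarse E k)
  rw [isBoundedSet_genCoarse_iff hdir hcov hfin] at hB
  refine hB.subset ?_
  rintro x ⟨hxD, y, hyD, hyx, hxy⟩
  by_contra hx
  have : y ∈ D ∩ entBall {p : ℕ × ℕ | E k p.1 p.2} x := ⟨hyD, hxy⟩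
  rw [hBD x ⟨hxD, hx⟩] at this
  exact hyx this

/-- Every sequence of distinct points has a discrete subsequence. -/
lemma exists_discrete_subsequence {X : Type u} {κ : Type} (E : κ → Setoid X)
    (hdir : Directed (· ≤ ·) E) (hcov : ∀ x y, ∃ k, E k x y)
    (hfin : ∀ k, FinitarySetoid (E k)) (hκ : Cardinal.mk κ < smallDeltaCard)
    {j : ℕ → X} (hj : Function.Injective j) :
    ∃ ψ : ℕ → ℕ, Function.Injective ψ ∧
      ∀ k, {n | ∃ m, m ≠ n ∧ E k (j (ψ n)) (j (ψ m))}.Finite := by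
  obtain ⟨D, hD, hdisc⟩ := exists_infinite_discrete (fun k => (E k).comap j)
    (fun k l => by
      obtain ⟨m, h1, h2⟩ := hdir k l
      exact ⟨m, fun _ _ h => h1 h, fun _ _ h => h2 h⟩)
    (fun x y => hcov (j x) (j y))
    (fun k => by
      obtain ⟨n, hn⟩ := hfin k
      refine ⟨n, fun x => ?_⟩
      have h1 : {y | (E k).comap j x y} = j ⁻¹' {y | E k (j x) y} := rfl
      have h2 := (hn (j x)).1.preimage hj.injOn
      refine ⟨h2, ?_⟩
      rw [h1, ← Set.ncard_image_of_injective _ hj]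
      exact (Set.ncard_le_ncard (Set.image_preimage_subset _ _) (hn (j x)).1).trans (hn (j x)).2)
    hκ
  set ψ := hD.natEmbedding D
  have hψ : Function.Injective fun n => (ψ n : ℕ) := Subtype.val_injective.comp ψ.injective
  refine ⟨fun n => ψ n, hψ, fun k => ?_⟩
  refine ((hdisc k).preimage hψ.injOn).subset ?_
  rintro n ⟨m, hmn, hE⟩
  exact ⟨(ψ n).2, _, (ψ m).2, fun h => hmn (hψ h), hE⟩

/-- A bounded function moved by `σ` on infinitely many points has a sequence of distinct
points on which its values are separated from its values on the `σ`-image. -/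
lemma exists_separated_sequence {X : Type u} {M : Type v} [MetricSpace M] [ProperSpace M]
    {φ : X → M} (hφ : Bornology.IsBounded (Set.range φ)) {σ : X → X} {ε : ℝ} (hε : 0 < ε)
    (hI : {x | ε ≤ dist (φ (σ x)) (φ x)}.Infinite) :
    ∃ j : ℕ → X, Function.Injective j ∧ ∀ n m, ε / 3 ≤ dist (φ (j n)) (φ (σ (j m))) := by
  set i₀ := hI.natEmbedding _
  set i : ℕ → X := fun n => (i₀ n : X)
  have hi : Function.Injective i := Subtype.val_injective.comp i₀.injective
  have hc := hφ.isCompact_closure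
  obtain ⟨⟨a, b⟩, -, ψ, hψ, hlim⟩ := (hc.prod hc).tendsto_subseq
    (x := fun n => (φ (i n), φ (σ (i n))))
    fun n => ⟨subset_closure ⟨_, rfl⟩, subset_closure ⟨_, rfl⟩⟩
  rw [Prod.tendsto_iff] at hlim
  have hε3 : 0 < ε / 3 := by positivity
  obtain ⟨N, hN⟩ := ((Metric.tendsto_nhds.1 hlim.1 _ hε3).and
    (Metric.tendsto_nhds.1 hlim.2 _ hε3)).exists_forall_of_atTop
  have hab : ε ≤ dist a b := by
    refine ge_of_tendsto (hlim.1.dist hlim.2) (Filter.Eventually.of_forall fun n => ?_)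
    have : ε ≤ dist (φ (σ (i (ψ n)))) (φ (i (ψ n))) := (i₀ (ψ n)).2
    rwa [dist_comm] at this
  refine ⟨fun n => i (ψ (n + N)), fun n m h => ?_, fun n m => ?_⟩
  · have := hψ.injective (hi h)
    omega
  · have h1 := (hN (n + N) (by omega)).1
    have h2 := (hN (m + N) (by omega)).2
    simp only [Function.comp] at h1 h2
    have := dist_triangle4 a (φ (i (ψ (n + N)))) (φ (σ (i (ψ (m + N))))) b
    rw [dist_comm a (φ _)] at this
    change ε / 3 ≤ dist (φ (i (ψ (n + N)))) (φ (σ (i (ψ (m + N)))))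
    linarith

/-- The inductive step: a small admissible family can be enlarged by one equivalence relation
so that a given function outside of `U` is no longer slowly oscillating. -/
lemma exists_destroying_setoid {X : Type u} {M : Type v} [MetricSpace M] [ProperSpace M]
    {U : Set (X → M)} {κ : Type} [Nonempty κ] (E : κ → Setoid X)
    (hdir : Directed (· ≤ ·) E) (hcov : ∀ x y, ∃ k, E k x y)
    (hadm : ∀ k, Admissible U (E k)) (hκ : Cardinal.mk κ < smallDeltaCard)
    {φ : X → M} (hφ : Bornology.IsBounded (Set.range φ))
    {σ : X → X} (hσ : Function.Injective σ)
    (hU : ∀ f ∈ U, ∀ ε : ℝ, 0 < ε → {x | ε ≤ dist (f (σ x)) (f x)}.Finite)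
    {ε : ℝ} (hε : 0 < ε) (hI : {x | ε ≤ dist (φ (σ x)) (φ x)}.Infinite) :
    ∃ P : Setoid X, (∀ k, Admissible U (E k ⊔ P)) ∧ ∃ k, ¬ SlowAlong (E k ⊔ P) φ := by
  by_cases hslow : ∀ k, SlowAlong (E k) φ
  swap
  · push Not at hslow
    obtain ⟨k, hk⟩ := hslow
    exact ⟨⊥, fun k => by simpa using hadm k, k, by simpa using hk⟩
  obtain ⟨j₀, hj₀, hsep₀⟩ := exists_separated_sequence hφ hε hI
  obtain ⟨ψ₁, hψ₁, hd₁⟩ := exists_discrete_subsequence E hdir hcov (fun k => (hadm k).1) hκ hj₀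
  obtain ⟨ψ₂, hψ₂, hd₂⟩ := exists_discrete_subsequence E hdir hcov (fun k => (hadm k).1) hκ
    (hσ.comp (hj₀.comp hψ₁))
  set j : ℕ → X := fun n => j₀ (ψ₁ (ψ₂ n))
  have hj : Function.Injective j := hj₀.comp (hψ₁.comp hψ₂)
  have hσj : Function.Injective fun n => σ (j n) := hσ.comp hj
  have hsep : ∀ n m, ε / 3 ≤ dist (φ (j n)) (φ (σ (j m))) := fun n m => hsep₀ _ _
  have hε3 : 0 < ε / 3 := by positivity
  refine ⟨pairSetoid j fun n => σ (j n), fun k => ?_, Classical.arbitrary κ, fun hs => ?_⟩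
  · refine admissible_sup_pairSetoid hj hσj (hadm k) ?_ ?_ (hd₂ k) ?_ ?_
    · intro f hf δ hδ
      refine ((hU f hf δ hδ).preimage hj.injOn).subset fun n hn => ?_
      change δ ≤ dist (f (σ (j n))) (f (j n))
      rw [dist_comm]
      exact hn
    · refine ((hd₁ k).preimage hψ₂.injOn).subset ?_
      rintro n ⟨m, hmn, hE⟩
      exact ⟨ψ₂ m, fun h => hmn (hψ₂ h), hE⟩
    · refine ((hslow k _ hε3).preimage hj.injOn).subset ?_
      rintro n ⟨m, hE⟩
      exact ⟨_, hE, hsep n m⟩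
    · refine ((hslow k _ hε3).preimage hσj.injOn).subset ?_
      rintro n ⟨m, hE⟩
      refine ⟨_, hE, ?_⟩
      rw [dist_comm]
      exact hsep m n
  · have hne : ∀ n m, j n ≠ σ (j m) := fun n m h => by
      have := hsep n m
      rw [← h, dist_self] at this
      linarith
    refine (Set.infinite_range_of_injective hj) ((hs _ hε3).subset ?_)
    rintro _ ⟨n, rfl⟩
    exact ⟨σ (j n), le_sup_right (a := E _) (pairSetoid_rel hσj hne n), hsep n n⟩

section Recursion

/-- The equivalence relation merging all points whose code is at most `n`. -/
def initialSetoid {X : Type u} (e : X → ℕ) (n : ℕ) : Setoid X :=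
  Setoid.ker fun x => max (e x) n

lemma initialSetoid_rel {X : Type u} {e : X → ℕ} {n : ℕ} {x y : X} :
    initialSetoid e n x y ↔ max (e x) n = max (e y) n := Iff.rfl

lemma initialSetoid_mono {X : Type u} (e : X → ℕ) : Monotone (initialSetoid e) := by
  intro m n hmn x y h
  rw [initialSetoid_rel] at h ⊢
  omega

lemma admissible_initialSetoid {X : Type u} {M : Type v} [MetricSpace M] {e : X → ℕ}
    (he : Function.Injective e) (U : Set (X → M)) (n : ℕ) :
    Admissible U (initialSetoid e n) := by
  have hfin : (e ⁻¹' Set.Iic n).Finite := (Set.finite_Iic n).preimage he.injOn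
  have hcase : ∀ x y, initialSetoid e n x y → e x ≤ n ∧ e y ≤ n ∨ y = x := by
    intro x y h
    rw [initialSetoid_rel] at h
    by_cases hx : e x ≤ n
    · exact Or.inl (by omega)
    · exact Or.inr (he (by omega))
  refine ⟨⟨(e ⁻¹' Set.Iic n).ncard + 1, fun x => ?_⟩, fun f _ ε hε => hfin.subset ?_⟩
  · have hsub : {y | initialSetoid e n x y} ⊆ insert x (e ⁻¹' Set.Iic n) := by
      intro y hy
      rcases hcase x y hy with h | h
      exacts [Or.inr h.2, Or.inl h]
    exact ⟨(hfin.insert x).subset hsub,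
      (Set.ncard_le_ncard hsub (hfin.insert x)).trans (Set.ncard_insert_le _ _)⟩
  · rintro x ⟨y, hxy, hd⟩
    rcases hcase x y hxy with h | h
    · exact h.1
    · rw [h, dist_self] at hd
      linarith

/-- The set of functions from a countable set to a separable metric space has cardinality at
most continuum. -/
lemma exists_injective_to_continuum (X : Type u) (M : Type v) [Countable X] [Nonempty X]
    [MetricSpace M] [TopologicalSpace.SeparableSpace M] [Nonempty M] :
    ∃ c : (X → M) → Cardinal.continuum.{0}.ord.ToType, Function.Injective c := by
  obtain ⟨s, hs⟩ := exists_surjective_nat X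
  have hcard : Cardinal.mk (ℕ → ℕ → ℝ) = Cardinal.mk Cardinal.continuum.{0}.ord.ToType := by
    simp only [Cardinal.mk_pi, Cardinal.prod_const, Cardinal.mk_real, Cardinal.mk_nat,
      Cardinal.lift_id, Cardinal.continuum_power_aleph0, Cardinal.mk_ord_toType]
  obtain ⟨g⟩ := Cardinal.eq.1 hcard
  refine ⟨fun φ => g fun n m => dist (φ (s n)) (TopologicalSpace.denseSeq M m), ?_⟩
  intro φ ψ h
  have h1 := g.injective h
  funext x
  obtain ⟨n, rfl⟩ := hs x
  have h2 : (fun z => dist (φ (s n)) z) = fun z => dist (ψ (s n)) z :=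
    (TopologicalSpace.denseRange_denseSeq M).equalizer (by fun_prop) (by fun_prop)
      (funext fun m => congrFun (congrFun h1 n) m)
  have h3 := congrFun h2 (φ (s n))
  simp only [dist_self] at h3
  exact (dist_eq_zero.1 h3.symm).symm

/-- Dependent choice along a well-order: a sequence whose terms satisfy `R`, relative to the
preceding terms, whenever this is possible. -/
lemma exists_sequence_of_relation {ι : Type w} [LinearOrder ι] [WellFoundedLT ι] {β : Type u}
    [Nonempty β] (R : ∀ i : ι, (Set.Iio i → β) → β → Prop) :
    ∃ P : ι → β, ∀ i, (∃ p, R i (fun j => P j) p) → R i (fun j => P j) (P i) := by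
  classical
  let F : ∀ i : ι, (∀ j, j < i → β) → β := fun i rec =>
    if h : ∃ p, R i (fun j => rec j.1 j.2) p then h.choose else Classical.arbitrary β
  refine ⟨(wellFounded_lt (α := ι)).fix F, fun i h => ?_⟩
  have hfix := (wellFounded_lt (α := ι)).fix_eq F i
  rw [hfix]
  simp only [F]
  rw [dif_pos h]
  exact h.choose_spec

lemma mk_finset_prod_nat_lt_continuum (i : Cardinal.continuum.{0}.ord.ToType) :
    Cardinal.mk (Finset (Set.Iio i) × ℕ) < Cardinal.continuum := by
  have hi : Cardinal.mk (Set.Iio i) < Cardinal.continuum := by simpa using Cardinal.mk_Iio_lt i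
  have hfin : Cardinal.mk (Finset (Set.Iio i)) < Cardinal.continuum := by
    cases finite_or_infinite (Set.Iio i) with
    | inl h => exact (Cardinal.lt_aleph0_of_finite _).trans Cardinal.aleph0_lt_continuum
    | inr h => rwa [Cardinal.mk_finset_of_infinite]
  rw [Cardinal.mk_prod, Cardinal.lift_id, Cardinal.lift_id]
  exact Cardinal.mul_lt_of_lt Cardinal.aleph0_le_continuum hfin
    (by simpa using Cardinal.aleph0_lt_continuum)

/-- If every bounded function outside of `U` is moved by an injection asymptotically
preserving all functions of `U`, then `U` consists of the slowly oscillating functions of a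
cellular finitary coarse structure. -/
lemma exists_cellular_finitary {X : Type u} {M : Type v} [Countable X] [Nonempty X]
    [MetricSpace M] [ProperSpace M] [Nonempty M] (hΔ : smallDeltaCard = Cardinal.continuum)
    (U : Set (X → M))
    (hU : ∀ φ : X → M, Bornology.IsBounded (Set.range φ) → φ ∉ U →
      ∃ σ : X → X, Function.Injective σ ∧
        (∀ f ∈ U, ∀ ε : ℝ, 0 < ε → {x | ε ≤ dist (f (σ x)) (f x)}.Finite) ∧
        ∃ ε : ℝ, 0 < ε ∧ {x | ε ≤ dist (φ (σ x)) (φ x)}.Infinite) :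
    ∃ 𝓔 : Set (Set (X × X)), IsCoarseStructure 𝓔 ∧ IsCellularCoarse 𝓔 ∧
      IsFinitaryCoarse 𝓔 ∧ (∀ B, IsBoundedSet 𝓔 B ↔ B.Finite) ∧
      ∀ φ : X → M, Bornology.IsBounded (Set.range φ) →
        (φ ∈ U ↔ SlowlyOscillating 𝓔 φ) := by
  classical
  obtain ⟨e, he⟩ := exists_injective_nat X
  obtain ⟨c, hc⟩ := exists_injective_to_continuum X M
  let ι := Cardinal.continuum.{0}.ord.ToType
  let fam : ∀ i : ι, (Set.Iio i → Setoid X) → Finset (Set.Iio i) × ℕ → Setoid X :=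
    fun i rec k => k.1.sup rec ⊔ initialSetoid e k.2
  obtain ⟨P, hP⟩ := exists_sequence_of_relation (fun (i : ι) rec (p : Setoid X) =>
    (∀ k, Admissible U (fam i rec k ⊔ p)) ∧
      ∀ φ, Bornology.IsBounded (Set.range φ) → φ ∉ U → c φ = i →
        ∃ k, ¬ SlowAlong (fam i rec k ⊔ p) φ)
  have hdir {α : Type} [DecidableEq α] (Q : α → Setoid X) :
      Directed (· ≤ ·) fun k : Finset α × ℕ => k.1.sup Q ⊔ initialSetoid e k.2 := fun k l =>
    ⟨(k.1 ∪ l.1, max k.2 l.2),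
      sup_le_sup (Finset.sup_mono Finset.subset_union_left)
        (initialSetoid_mono e (le_max_left _ _)),
      sup_le_sup (Finset.sup_mono Finset.subset_union_right)
        (initialSetoid_mono e (le_max_right _ _))⟩
  have hcov {α : Type} (Q : α → Setoid X) (x y : X) :
      ∃ k : Finset α × ℕ, (k.1.sup Q ⊔ initialSetoid e k.2) x y :=
    ⟨(∅, e x + e y), le_sup_right (a := Finset.sup ∅ Q)
      (initialSetoid_rel.2 (by dsimp only; omega))⟩
  have hsup : ∀ (t : Finset ι) (n : ℕ),
      (∀ i ∈ t, ∀ k, Admissible U (fam i (fun j => P j) k ⊔ P i)) →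
        Admissible U (t.sup P ⊔ initialSetoid e n) := by
    intro t n h
    rcases t.eq_empty_or_nonempty with rfl | hne
    · simpa using admissible_initialSetoid he U n
    · let m := t.max' hne
      refine (h m (t.max'_mem hne) (t.subtype (· ∈ Set.Iio m), n)).mono ?_
      refine sup_le (Finset.sup_le fun j hj => ?_) (le_sup_right.trans le_sup_left)
      rcases (t.le_max' j hj).lt_or_eq with hlt | heq
      · refine le_trans ?_ (le_sup_left.trans le_sup_left)
        exact Finset.le_sup (f := fun j : Set.Iio m => P j) (b := ⟨j, hlt⟩)
          (Finset.mem_subtype.2 hj)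
      · rw [heq]
        exact le_sup_right
  have hstep : ∀ i, (∀ k, Admissible U (fam i (fun j => P j) k ⊔ P i)) ∧
      ∀ φ, Bornology.IsBounded (Set.range φ) → φ ∉ U → c φ = i →
        ∃ k, ¬ SlowAlong (fam i (fun j => P j) k ⊔ P i) φ := by
    intro i
    induction i using WellFoundedLT.induction with
    | ind i ih =>
      have hadm : ∀ k, Admissible U (fam i (fun j => P j) k) := by
        rintro ⟨t, n⟩
        have := hsup (t.image Subtype.val) n fun j hj => by
          obtain ⟨j, -, rfl⟩ := Finset.mem_image.1 hj
          exact (ih j j.2).1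
        rwa [Finset.sup_image] at this
      apply hP
      by_cases hφ : ∃ φ, Bornology.IsBounded (Set.range φ) ∧ φ ∉ U ∧ c φ = i
      · obtain ⟨φ, hb, hφU, rfl⟩ := hφ
        obtain ⟨σ, hσ, hσU, ε, hε, hI⟩ := hU φ hb hφU
        obtain ⟨p, hp, hk⟩ := exists_destroying_setoid (fam (c φ) fun j => P j)
          (hdir _) (hcov _) hadm ((mk_finset_prod_nat_lt_continuum _).trans_eq hΔ.symm)
          hb hσ hσU hε hI
        refine ⟨p, hp, fun ψ _ _ hψ => ?_⟩
        rwa [hc hψ]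
      · exact ⟨⊥, by simpa using hadm, fun φ h1 h2 h3 => absurd ⟨φ, h1, h2, h3⟩ hφ⟩
  set E : Finset ι × ℕ → Setoid X := fun k => k.1.sup P ⊔ initialSetoid e k.2
  have hE : ∀ k, Admissible U (E k) := fun k => hsup k.1 k.2 fun i _ => (hstep i).1
  have hfin : ∀ k, FinitarySetoid (E k) := fun k => (hE k).1
  refine ⟨genCoarse E, isCoarseStructure_genCoarse (hdir P) (hcov P),
    isCellularCoarse_genCoarse E, isFinitaryCoarse_genCoarse hfin,
    isBoundedSet_genCoarse_iff (hdir P) (hcov P) hfin, fun φ hφ => ?_⟩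
  rw [slowlyOscillating_genCoarse_iff (hdir P) (hcov P) hfin]
  refine ⟨fun h k => (hE k).2 φ h, fun h => ?_⟩
  by_contra hφU
  obtain ⟨⟨t, n⟩, hk⟩ := (hstep (c φ)).2 φ hφ hφU rfl
  refine hk ((h (insert (c φ) (t.image Subtype.val), n)).mono ?_)
  refine sup_le (sup_le_sup_right ?_ _) (le_trans ?_ le_sup_left)
  · rw [Finset.sup_insert, Finset.sup_image]
    exact le_sup_right
  · exact Finset.le_sup (f := P) (Finset.mem_insert_self _ _)

end Recursion

section Compactifications

/-- If the bounded sets are the finite ones, then the functions that extend continuously to the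
`M`-compactification are the bounded slowly oscillating ones. -/
lemma ucHComp_eq_soSet {X : Type u} {M : Type v} [MetricSpace M] [ProperSpace M]
    {𝓔 : Set (Set (X × X))} (hent : ∀ E ∈ 𝓔, IsEntourage E)
    (hbdd : ∀ B, IsBoundedSet 𝓔 B ↔ B.Finite) :
    ucHComp 𝓔 M = soSet 𝓔 M := by
  have hcomp : IsCompact (hCompSet 𝓔 M) := by
    refine (isCompact_univ_pi fun φ : soSet 𝓔 M => φ.2.1.isCompact_closure).of_isClosed_subset
      isClosed_closure (closure_minimal ?_ (isClosed_set_pi fun φ _ => isClosed_closure))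
    rintro _ ⟨x, rfl⟩ φ -
    exact subset_closure ⟨x, rfl⟩
  have : CompactSpace (HComp 𝓔 M) := isCompact_iff_compactSpace.1 hcomp
  refine Set.Subset.antisymm ?_ fun φ hφ =>
    ⟨fun p => p.1 ⟨φ, hφ⟩, (continuous_apply _).comp continuous_subtype_val, fun _ => rfl⟩
  rintro φ ⟨f, hf, hfφ⟩
  refine ⟨(isCompact_range hf).isBounded.subset ?_, fun ε hε E hE => ?_⟩
  · rintro _ ⟨x, rfl⟩
    exact ⟨_, hfφ x⟩
  have hε3 : 0 < ε / 3 := by positivity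
  set B : Set X := {x | ∃ y ∈ entBall E x, ε / 3 ≤ dist (φ x) (φ y)} with hB
  have hBfin : B.Finite := by
    by_contra hinf
    have hinf : B.Infinite := hinf
    have : (cofinite ⊓ 𝓟 B).NeBot := Filter.cofinite_inf_principal_neBot_iff.2 hinf
    choose! y hyE hyd using fun x (hx : x ∈ B) => hx
    let 𝒰 := Ultrafilter.of (cofinite ⊓ 𝓟 B)
    have h𝒰 : (𝒰 : Filter X) ≤ cofinite ⊓ 𝓟 B := Ultrafilter.of_le _
    have h𝒰B : ∀ᶠ x in (𝒰 : Filter X), x ∈ B := h𝒰 (Filter.mem_inf_of_right (mem_principal_self B))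
    obtain ⟨p, -, hp⟩ := isCompact_univ.ultrafilter_le_nhds
      (𝒰.map (deltaEmb 𝓔 M)) (by simp)
    obtain ⟨q, -, hq⟩ := isCompact_univ.ultrafilter_le_nhds
      (𝒰.map fun x => deltaEmb 𝓔 M (y x)) (by simp)
    have hp : Tendsto (deltaEmb 𝓔 M) 𝒰 (𝓝 p) := hp
    have hq : Tendsto (fun x => deltaEmb 𝓔 M (y x)) 𝒰 (𝓝 q) := hq
    have hpq : p = q := by
      refine Subtype.ext (funext fun ψ => ?_)
      have h1 : Tendsto (fun x => ψ.1 x) 𝒰 (𝓝 (p.1 ψ)) :=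
        (((continuous_apply ψ).comp continuous_subtype_val).tendsto p).comp hp
      have h2 : Tendsto (fun x => ψ.1 (y x)) 𝒰 (𝓝 (q.1 ψ)) :=
        (((continuous_apply ψ).comp continuous_subtype_val).tendsto q).comp hq
      refine eq_of_forall_dist_le fun δ hδ => ?_
      refine le_of_tendsto (h1.dist h2) ?_
      obtain ⟨A, hA, hAψ⟩ := ψ.2.2 δ hδ E hE
      rw [hbdd] at hA
      have hAc : ∀ᶠ x in (𝒰 : Filter X), x ∉ A :=
        h𝒰 (Filter.mem_inf_of_left hA.compl_mem_cofinite)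
      filter_upwards [hAc, h𝒰B] with x hxA hxB
      have h3 := (Metric.edist_le_ediam_of_mem (s := ψ.1 '' entBall E x)
        (Set.mem_image_of_mem _ (hent E hE x))
        (Set.mem_image_of_mem _ (hyE x hxB))).trans_lt (hAψ x hxA)
      rw [edist_dist, ENNReal.ofReal_lt_ofReal_iff hδ] at h3
      exact h3.le
    have h1 := (hf.tendsto p).comp hp
    have h2 := (hf.tendsto q).comp hq
    have h3 := h1.dist h2
    rw [hpq, dist_self] at h3
    have h4 : ε / 3 ≤ 0 := by
      refine ge_of_tendsto h3 ?_
      filter_upwards [h𝒰B] with x hxB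
      simpa only [Function.comp, hfφ] using hyd x hxB
    linarith
  refine ⟨B, (hbdd B).2 hBfin, fun x hx => ?_⟩
  have near : ∀ y ∈ entBall E x, dist (φ x) (φ y) < ε / 3 := fun y hy => by
    by_contra hlt
    exact hx ⟨y, hy, not_lt.mp hlt⟩
  refine lt_of_le_of_lt (Metric.ediam_le (d := ENNReal.ofReal (2 * (ε / 3))) ?_)
    ((ENNReal.ofReal_lt_ofReal_iff hε).2 (by linarith))
  rintro _ ⟨y, hy, rfl⟩ _ ⟨z, hz, rfl⟩
  rw [edist_dist]
  refine ENNReal.ofReal_le_ofReal ?_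
  have := near y hy
  have := near z hz
  have := dist_triangle_left (φ y) (φ z) (φ x)
  linarith

variable {K : Type u} [TopologicalSpace K] {M : Type v} [MetricSpace M]

lemma countable_isolatedPoints [TopologicalSpace.SeparableSpace K] :
    (isolatedPoints K).Countable := by
  obtain ⟨s, hs, hd⟩ := TopologicalSpace.exists_countable_dense K
  refine hs.mono fun x hx => ?_
  obtain ⟨y, rfl, hy⟩ := hd.inter_open_nonempty {x} hx ⟨x, rfl⟩
  exact hy

lemma isBounded_range_of_mem_ucSet [CompactSpace K] {φ : isolatedPoints K → M}
    (hφ : φ ∈ ucSet K M) : Bornology.IsBounded (Set.range φ) := by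
  obtain ⟨f, hf, hfφ⟩ := hφ
  refine (isCompact_range hf).isBounded.subset ?_
  rintro _ ⟨x, rfl⟩
  exact ⟨_, hfφ x⟩

/-- Permutations induced by homeomorphisms fixing the remainder asymptotically preserve
continuously extendable functions. -/
lemma finite_dist_of_mem_homeoPerms [CompactSpace K] {σ : Equiv.Perm (isolatedPoints K)}
    (hσ : σ ∈ homeoPerms K) {φ : isolatedPoints K → M} (hφ : φ ∈ ucSet K M) {ε : ℝ}
    (hε : 0 < ε) : {x | ε ≤ dist (φ (σ x)) (φ x)}.Finite := by
  obtain ⟨h, hfix, hσ⟩ := hσ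
  obtain ⟨f, hf, hfφ⟩ := hφ
  by_contra hinf
  have hinf' : (Subtype.val '' {x | ε ≤ dist (φ (σ x)) (φ x)}).Infinite :=
    Set.Infinite.image Subtype.val_injective.injOn hinf
  obtain ⟨z, -, hz⟩ := hinf'.exists_accPt_of_subset_isCompact isCompact_univ (Set.subset_univ _)
  rw [accPt_iff_nhds] at hz
  have hzK : z ∉ isolatedPoints K := fun hzK => by
    obtain ⟨y, ⟨hy, -⟩, hyz⟩ := hz {z} (IsOpen.mem_nhds hzK rfl)
    exact hyz hy
  have hg : Continuous fun w => dist (f (h w)) (f w) :=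
    (hf.comp h.continuous).dist hf
  have hgz : ∀ᶠ w in 𝓝 z, dist (f (h w)) (f w) < ε :=
    hg.continuousAt.eventually_lt continuousAt_const (by simpa [hfix z hzK] using hε)
  obtain ⟨_, ⟨hy, x, hx, rfl⟩, -⟩ := hz _ hgz
  have hy : dist (f (h x)) (f x) < ε := hy
  rw [hσ, hfφ, hfφ] at hy
  exact absurd hx (not_le.2 hy)

/-- A function with vanishing oscillation extends continuously. -/
lemma mem_ucSet_of_oscAt_eq_zero [CompleteSpace M] (hd : Dense (isolatedPoints K))
    {φ : isolatedPoints K → M} (hφ : ∀ z, oscAt φ z = 0) : φ ∈ ucSet K M := by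
  have hlim : ∀ z : K, ∃ c, Tendsto φ (comap Subtype.val (𝓝 z)) (𝓝 c) := by
    intro z
    have hne : (comap (Subtype.val : isolatedPoints K → K) (𝓝 z)).NeBot :=
      hd.isDenseInducing_val.comap_nhds_neBot z
    refine cauchy_map_iff_exists_tendsto.1 (EMetric.cauchy_iff.2 ⟨hne.map φ |>.ne, fun ε hε => ?_⟩)
    have h0 : oscAt φ z < ε := (hφ z).trans_lt hε
    simp only [oscAt, iInf_lt_iff] at h0
    obtain ⟨O, hO, hzO, hdiam⟩ := h0
    refine ⟨_, image_mem_map (preimage_mem_comap (hO.mem_nhds hzO)), ?_⟩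
    exact fun x hx y hy => (Metric.edist_le_ediam_of_mem hx hy).trans_lt hdiam
  refine ⟨hd.isDenseInducing_val.extend φ, hd.isDenseInducing_val.continuous_extend hlim,
    fun x => ?_⟩
  refine hd.isDenseInducing_val.extend_eq_of_tendsto ?_
  have hx : {x} ∈ comap (Subtype.val : isolatedPoints K → K) (𝓝 x) :=
    ⟨{x.1}, IsOpen.mem_nhds x.2 rfl, fun y hy => Subtype.ext hy⟩
  refine tendsto_nhds_of_eventually_eq ?_
  filter_upwards [hx] with y hy
  rw [hy]

end Compactifications

end CellularCoarse

open CellularCoarse in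
/-- Under `Δ = 𝔠`, each separable `M`-soft compactification `K` is
`M`-equivalent to the `M`-compactification of `K'` endowed with a suitable cellular
finitary coarse structure. -/
theorem statement7 (M : Type v) [MetricSpace M] [ProperSpace M] [Nontrivial M]
    (hΔ : smallDeltaCard = Cardinal.continuum)
    (K : Type u) [TopologicalSpace K] [TopologicalSpace.SeparableSpace K]
    (hK : IsCompactification K) (hsoft : IsMSoft K M) :
    ∃ 𝓔 : Set (Set (↥(isolatedPoints K) × ↥(isolatedPoints K))),
      IsCoarseStructure 𝓔 ∧ IsCellularCoarse 𝓔 ∧ IsFinitaryCoarse 𝓔 ∧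
      ucSet K M = ucHComp 𝓔 M := by
  obtain ⟨hcpt, -, hdense⟩ := hK
  have : Countable (isolatedPoints K) := countable_isolatedPoints.to_subtype
  rcases isEmpty_or_nonempty (isolatedPoints K) with hempty | hne
  · have hKe : IsEmpty K := by
      by_contra h
      rw [not_isEmpty_iff] at h
      obtain ⟨x, hx⟩ := hdense.nonempty
      exact hempty.false ⟨x, hx⟩
    have hHe : IsEmpty (HComp (genCoarse fun _ : Unit => (⊤ : Setoid (isolatedPoints K))) M) := by
      refine ⟨fun p => ?_⟩
      have hp := p.2
      simp [hCompSet, Set.range_eq_empty] at hp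
    refine ⟨genCoarse fun _ : Unit => ⊤, ?_, isCellularCoarse_genCoarse _, ?_, ?_⟩
    · exact isCoarseStructure_genCoarse (fun _ _ => ⟨(), le_rfl, le_rfl⟩) fun x => isEmptyElim x
    · exact isFinitaryCoarse_genCoarse fun _ => ⟨0, fun x => isEmptyElim x⟩
    · ext φ
      exact iff_of_true ⟨fun x => isEmptyElim x, continuous_of_const fun x => isEmptyElim x,
        fun x => isEmptyElim x⟩ ⟨fun x => isEmptyElim x, continuous_of_const fun x => isEmptyElim x,
        fun x => isEmptyElim x⟩
  obtain ⟨𝓔, hcoarse, hcell, hfin, hbdd, hso⟩ := exists_cellular_finitary hΔ (ucSet K M)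
    fun φ hφ hφU => by
      have hosc : ∃ z : K, 0 < oscAt φ z := by
        by_contra hz
        push Not at hz
        exact hφU (mem_ucSet_of_oscAt_eq_zero hdense fun z => le_antisymm (hz z) zero_le)
      obtain ⟨σ, hσ, hI⟩ := hsoft φ hφ hosc
      exact ⟨σ, σ.injective, fun f hf ε hε => finite_dist_of_mem_homeoPerms hσ hf hε, hI⟩
  refine ⟨𝓔, hcoarse, hcell, hfin, ?_⟩
  rw [ucHComp_eq_soSet hcoarse.ent hbdd]
  ext φ
  constructor
  · intro hφ
    have hb := isBounded_range_of_mem_ucSet hφ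
    exact ⟨hb, (hso φ hb).1 hφ⟩
  · rintro ⟨hb, hs⟩
    exact (hso φ hb).2 hs
end

section
/- Every soft compactification is ℝ-soft. -/
open Set Filter Topology

universe u u₁ u₂ v w

/-- A function with values in a compact set and positive oscillation at `z` has two distinct
cluster values at `z`. -/
theorem exists_clusterPt_ne_of_oscAt_pos {K : Type w} [TopologicalSpace K] {M : Type v}
    [MetricSpace M] {φ : ↥(isolatedPoints K) → M} {s : Set M} (hs : IsCompact s)
    (hφ : Set.range φ ⊆ s) {z : K} [(comap Subtype.val (𝓝 z) : Filter (isolatedPoints K)).NeBot]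
    (hz : 0 < oscAt φ z) :
    ∃ a b : M, a ≠ b ∧
      ClusterPt a (map φ (comap Subtype.val (𝓝 z))) ∧
      ClusterPt b (map φ (comap Subtype.val (𝓝 z))) := by
  have hs_mem : s ∈ map φ (comap Subtype.val (𝓝 z)) :=
    mem_map.2 (univ_mem' fun x => hφ (mem_range_self x))
  obtain ⟨a, -, ha⟩ := hs (le_principal_iff.2 hs_mem)
  by_contra! hunique
  have hlim : map φ (comap Subtype.val (𝓝 z)) ≤ 𝓝 a :=
    hs.le_nhds_of_unique_clusterPt hs_mem fun b _ hb => by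
      by_contra hne
      exact hunique a b (Ne.symm hne) ha hb
  refine hz.not_ge (le_of_forall_pos_le_add fun ε hε => ?_)
  have hball : Metric.eball a (ε / 2) ∈ 𝓝 a := Metric.eball_mem_nhds a (ENNReal.half_pos hε.ne')
  obtain ⟨t, ht, htφ⟩ := mem_comap.1 (mem_map.1 (hlim hball))
  obtain ⟨O, hOt, hO, hzO⟩ := mem_nhds_iff.1 ht
  rw [zero_add]
  refine (iInf₂_le_of_le O hO (iInf_le _ hzO)).trans ?_
  calc
    Metric.ediam (φ '' (Subtype.val ⁻¹' O)) ≤ Metric.ediam (Metric.eball a (ε / 2)) :=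
      Metric.ediam_mono (image_subset_iff.2 fun x hx => htφ (hOt hx))
    _ ≤ 2 * (ε / 2) := Metric.ediam_eball_le
    _ = ε := ENNReal.mul_div_cancel two_ne_zero ENNReal.ofNat_ne_top

/-- If `a` is a cluster value of `φ` at `z`, then the preimage of any neighborhood of `a`
accumulates at `z`. -/
theorem mem_closure_image_of_clusterPt {K : Type w} [TopologicalSpace K] {M : Type v}
    [TopologicalSpace M] {φ : ↥(isolatedPoints K) → M} {z : K} {a : M}
    (ha : ClusterPt a (map φ (comap Subtype.val (𝓝 z)))) {U : Set M} (hU : U ∈ 𝓝 a) :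
    z ∈ closure (Subtype.val '' (φ ⁻¹' U)) := by
  refine mem_closure_iff_nhds.2 fun t ht => ?_
  obtain ⟨_, hxU, x, hxt, rfl⟩ := clusterPt_iff_nonempty.1 ha hU
    (image_mem_map (preimage_mem_comap ht))
  exact ⟨x, hxt, x, hxU, rfl⟩

/-- Every soft compactification is `ℝ`-soft. -/
theorem statement8 (K : Type u) [TopologicalSpace K] (hK : IsCompactification K)
    (hsoft : IsSoft K) : IsMSoft K ℝ := by
  rintro φ hφ ⟨z, hz⟩
  have : (comap Subtype.val (𝓝 z) : Filter (isolatedPoints K)).NeBot :=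
    mem_closure_iff_comap_neBot.1 (hK.2.2 z)
  obtain ⟨a, b, hab, ha, hb⟩ :=
    exists_clusterPt_ne_of_oscAt_pos hφ.isCompact_closure subset_closure hz
  have hpos : 0 < dist a b / 3 := div_pos (dist_pos.2 hab) three_pos
  have hsep : ∀ x y, dist (φ x) a < dist a b / 3 → dist (φ y) b < dist a b / 3 →
      dist a b / 3 ≤ dist (φ y) (φ x) := fun x y hx hy => by
    have h := dist_triangle4 a (φ x) (φ y) b
    rw [dist_comm a (φ x), dist_comm (φ x) (φ y)] at h
    linarith
  have hdisj : Disjoint (φ ⁻¹' Metric.ball a (dist a b / 3))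
      (φ ⁻¹' Metric.ball b (dist a b / 3)) := by
    refine Set.disjoint_left.2 fun x hx hy => ?_
    have h := hsep x x hx hy
    rw [dist_self] at h
    linarith
  obtain ⟨σ, hσ, hinf⟩ := hsoft _ _ hdisj
    ⟨z, mem_closure_image_of_clusterPt ha (Metric.ball_mem_nhds a hpos),
      mem_closure_image_of_clusterPt hb (Metric.ball_mem_nhds b hpos)⟩
  exact ⟨σ, hσ, dist a b / 3, hpos, hinf.mono fun x hx => hsep x (σ x) hx.1 hx.2⟩
end

section
/- Every compact Hausdorff space K which is a corona of character χ(K) < 𝔭 is a soft corona. -/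
open Set Filter Topology

universe u u₁ u₂ v w

/-- A family of fewer than `𝔭` subsets of `ℕ` with the strong finite intersection property
has an infinite pseudo-intersection. -/
theorem exists_pseudoIntersection_of_lt_pCard {ι : Type u}
    (hι : Cardinal.mk ι < Cardinal.lift.{u} pCard) (f : ι → Set ℕ)
    (hf : ∀ s : Finset ι, (⋂ i ∈ s, f i).Infinite) :
    ∃ I : Set ℕ, I.Infinite ∧ ∀ i, (I \ f i).Finite := by
  by_contra! hcon
  have hle : Cardinal.lift.{u} (Cardinal.mk ↥(range f)) ≤ Cardinal.mk ι := by
    simpa using Cardinal.mk_range_le_lift (f := f)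
  refine notMem_of_lt_csInf' (Cardinal.lift_lt.1 (hle.trans_lt hι))
    ⟨range f, ?_, ?_, ?_, rfl⟩
  · rintro _ ⟨i, rfl⟩
    simpa using hf {i}
  · intro S hS
    classical
    obtain ⟨s, rfl⟩ : ∃ s : Finset ι, s.image f = S := by
      obtain ⟨s, -, hs⟩ := Finset.subset_set_image_iff.1
        (show (S : Set (Set ℕ)) ⊆ f '' univ by rwa [image_univ])
      exact ⟨s, hs⟩
    simpa using hf s
  · intro I hI
    obtain ⟨i, hi⟩ := hcon I hI
    exact ⟨f i, mem_range_self i, hi⟩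

/-- The character of a point is attained by some neighborhood base. -/
theorem exists_base_mk_eq_charAt (K : Type w) [TopologicalSpace K] (x : K) :
    ∃ 𝓑 : Set (Set K), (∀ U ∈ 𝓑, IsOpen U ∧ x ∈ U) ∧
      (∀ V : Set K, IsOpen V → x ∈ V → ∃ U ∈ 𝓑, U ⊆ V) ∧
      Cardinal.mk ↥𝓑 = charAt K x :=
  csInf_mem (s := {c : Cardinal.{w} | ∃ 𝓑 : Set (Set K), (∀ U ∈ 𝓑, IsOpen U ∧ x ∈ U) ∧
    (∀ V : Set K, IsOpen V → x ∈ V → ∃ U ∈ 𝓑, U ⊆ V) ∧ Cardinal.mk ↥𝓑 = c})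
    ⟨_, {U | IsOpen U ∧ x ∈ U}, fun _ h => h, fun V h h' => ⟨V, ⟨h, h'⟩, Subset.rfl⟩, rfl⟩

/-- A family of closed neighborhoods of `z` of size at most the character of the remainder
that determines `z` within the remainder. -/
theorem exists_closed_nhds_remainder {K C : Type u} [TopologicalSpace K] [TopologicalSpace C]
    [CompactSpace C] [T2Space C] {R : Set C} (e : K ≃ₜ R) {z : C} (hz : z ∈ R) :
    ∃ (ι : Type u) (_ : Nonempty ι) (N : ι → Set C), Cardinal.mk ι ≤ spaceChar K ∧
      (∀ i, IsClosed (N i)) ∧ (∀ i, N i ∈ 𝓝 z) ∧ ∀ y ∈ R, (∀ i, y ∈ N i) → y = z := by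
  obtain ⟨𝓑, h𝓑, hbase, hcard⟩ := exists_base_mk_eq_charAt K (e.symm ⟨z, hz⟩)
  have key : ∀ U : 𝓑, ∃ N : Set C, IsClosed N ∧ N ∈ 𝓝 z ∧
      ∀ y (hy : y ∈ R), y ∈ N → e.symm ⟨y, hy⟩ ∈ U.1 := by
    intro U
    obtain ⟨W, hW, hWU⟩ := isOpen_induced_iff.1
      ((h𝓑 U U.2).1.preimage e.symm.continuous)
    have hzW : z ∈ W := by
      have : (⟨z, hz⟩ : R) ∈ Subtype.val ⁻¹' W := by rw [hWU]; exact (h𝓑 U U.2).2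
      exact this
    obtain ⟨N, hN, hNc, hNW⟩ := exists_mem_nhds_isClosed_subset (hW.mem_nhds hzW)
    refine ⟨N, hNc, hN, fun y hy hyN => ?_⟩
    have : (⟨y, hy⟩ : R) ∈ Subtype.val ⁻¹' W := hNW hyN
    rwa [hWU] at this
  choose N hN hNz hNU using key
  obtain ⟨U₀, hU₀, -⟩ := hbase univ isOpen_univ trivial
  refine ⟨𝓑, ⟨⟨U₀, hU₀⟩⟩, N, ?_, hN, hNz, fun y hy hyN => ?_⟩
  · rw [hcard]
    exact le_ciSup (Cardinal.bddAbove_of_small) _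
  · by_contra hne
    have hne' : e.symm ⟨z, hz⟩ ≠ e.symm ⟨y, hy⟩ := fun h =>
      hne (congrArg Subtype.val (e.symm.injective h)).symm
    have : T1Space K := e.isEmbedding.t1Space
    obtain ⟨U, hU, hUV⟩ := hbase {e.symm ⟨y, hy⟩}ᶜ isOpen_compl_singleton hne'
    exact hUV (hNU ⟨U, hU⟩ y hy (hyN _)) rfl

/-- In a compactification of a countable discrete space whose remainder has character `< 𝔭`,
every point of the remainder in the closure of a set of isolated points is the limit of an
infinite subset of it. -/
theorem exists_infinite_subset_converging {K C : Type u} [TopologicalSpace K]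
    [TopologicalSpace C] [CompactSpace C] [T2Space C] (hinf : (isolatedPoints C).Infinite)
    (hcount : (isolatedPoints C).Countable) (e : K ≃ₜ ↥((isolatedPoints C)ᶜ))
    (hchar : spaceChar K < Cardinal.lift.{u} pCard) {A : Set C} (hA : A ⊆ isolatedPoints C)
    {z : C} (hz : z ∉ isolatedPoints C) (hzA : z ∈ closure A) :
    ∃ P ⊆ A, P.Infinite ∧ ∀ V ∈ 𝓝 z, (P \ V).Finite := by
  obtain ⟨ι, ⟨i₀⟩, N, hι, hNc, hNz, hN⟩ := exists_closed_nhds_remainder e hz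
  have := hcount.to_subtype
  have := hinf.to_subtype
  obtain ⟨d⟩ := nonempty_denumerable (isolatedPoints C)
  let φ : ℕ → C := fun n => ((Denumerable.eqv (isolatedPoints C)).symm n : C)
  have hφ : Function.Injective φ := Subtype.val_injective.comp (Equiv.injective _)
  have hφA : ∀ x ∈ A, ∃ n, φ n = x := fun x hx =>
    ⟨Denumerable.eqv (isolatedPoints C) ⟨x, hA hx⟩, by simp [φ]⟩
  have hAV : ∀ V ∈ 𝓝 z, (A ∩ V).Infinite := by
    intro V hV hfin
    have hnotin : z ∉ A ∩ V := fun h => hz (hA h.1)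
    obtain ⟨x, ⟨hxV, hx⟩, hxA⟩ := mem_closure_iff_nhds.1 hzA _
      (inter_mem hV (hfin.isClosed.isOpen_compl.mem_nhds hnotin))
    exact hx ⟨hxA, hxV⟩
  obtain ⟨I, hI, hIN⟩ := exists_pseudoIntersection_of_lt_pCard (hι.trans_lt hchar)
    (fun i => φ ⁻¹' (A ∩ N i)) (by
      intro s hfin
      refine hAV (⋂ i ∈ s, N i) ((Filter.biInter_finset_mem s).2 fun i _ => hNz i)
        ((hfin.image φ).subset ?_)
      rintro x ⟨hxA, hx⟩
      obtain ⟨n, rfl⟩ := hφA x hxA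
      refine ⟨n, ?_, rfl⟩
      simp only [mem_iInter] at hx ⊢
      exact fun i hi => ⟨hxA, hx i hi⟩)
  refine ⟨φ '' I ∩ A, inter_subset_right, ?_, fun V hV => ?_⟩
  · have : (φ '' (I \ (I \ φ ⁻¹' (A ∩ N i₀)))).Infinite :=
      (hI.sdiff (hIN i₀)).image hφ.injOn
    refine this.mono ?_
    rintro _ ⟨n, ⟨hn, hn'⟩, rfl⟩
    have : φ n ∈ A ∩ N i₀ := by
      by_contra h
      exact hn' ⟨hn, h⟩
    exact ⟨mem_image_of_mem _ hn, this.1⟩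
  · by_contra hS
    set S := (φ '' I ∩ A) \ V with hSdef
    obtain ⟨y, -, hy⟩ := Set.Infinite.exists_accPt_of_subset_isCompact hS isCompact_univ
      (subset_univ S)
    rw [accPt_iff_nhds] at hy
    have hyR : y ∈ (isolatedPoints C)ᶜ := by
      intro hyi
      obtain ⟨x, hx, hne⟩ := hy {y} (IsOpen.mem_nhds hyi rfl)
      exact hne hx.1
    have hyz : y = z := by
      refine hN y hyR fun i => ?_
      by_contra hyN
      have hfin : (φ '' (I \ φ ⁻¹' (A ∩ N i)) \ {y}).Finite := ((hIN i).image φ).sdiff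
      obtain ⟨x, ⟨⟨hx1, hx2⟩, ⟨⟨n, hn, rfl⟩, hxA⟩, -⟩, hne⟩ := hy _ (inter_mem
        ((hNc i).isOpen_compl.mem_nhds hyN)
        (hfin.isClosed.isOpen_compl.mem_nhds fun h => h.2 rfl))
      exact hx2 ⟨⟨n, ⟨hn, fun h => hx1 h.2⟩, rfl⟩, hne⟩
    subst hyz
    obtain ⟨x, ⟨hxV, hx⟩, -⟩ := hy V hV
    exact hx.2 hxV

/-- Two disjoint countably infinite sets can be swapped by an involution that is the identity
elsewhere. -/
theorem exists_involutive_swap {α : Type*} {P Q : Set α} (hP : P.Infinite) (hQ : Q.Infinite)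
    (hPc : P.Countable) (hQc : Q.Countable) (hPQ : Disjoint P Q) :
    ∃ h : α → α, Function.Involutive h ∧ MapsTo h P Q ∧ MapsTo h Q P ∧
      ∀ x, x ∉ P → x ∉ Q → h x = x := by
  classical
  have := hP.to_subtype
  have := hQ.to_subtype
  have := hPc.to_subtype
  have := hQc.to_subtype
  obtain ⟨_⟩ := nonempty_denumerable P
  obtain ⟨_⟩ := nonempty_denumerable Q
  let φ : P ≃ Q := Denumerable.equiv₂ P Q
  have hQP : ∀ x ∈ Q, x ∉ P := fun x hx hx' => disjoint_left.1 hPQ hx' hx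
  let h : α → α := fun x =>
    if hx : x ∈ P then φ ⟨x, hx⟩ else if hx : x ∈ Q then φ.symm ⟨x, hx⟩ else x
  have h1 : ∀ x (hx : x ∈ P), h x = φ ⟨x, hx⟩ := fun x hx => dif_pos hx
  have h2 : ∀ x (hx : x ∈ Q), h x = φ.symm ⟨x, hx⟩ := fun x hx => by
    simp only [h, dif_neg (hQP x hx), dif_pos hx]
  have h3 : ∀ x, x ∉ P → x ∉ Q → h x = x := fun x hx hx' => by
    simp only [h, dif_neg hx, dif_neg hx']
  refine ⟨h, fun x => ?_, fun x hx => ?_, fun x hx => ?_, h3⟩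
  · by_cases hx : x ∈ P
    · rw [h1 x hx, h2 _ (φ ⟨x, hx⟩).2]
      simp
    · by_cases hx' : x ∈ Q
      · rw [h2 x hx', h1 _ (φ.symm ⟨x, hx'⟩).2]
        simp
      · rw [h3 x hx hx', h3 x hx hx']
  · rw [h1 x hx]
    exact (φ _).2
  · rw [h2 x hx]
    exact (φ.symm _).2

/-- A map swapping two sets of isolated points converging to the same point `z`, and fixing all
other points, is continuous. -/
theorem continuous_of_swap_converging {C : Type*} [TopologicalSpace C] [T2Space C]
    {P Q : Set C} (hP : P ⊆ isolatedPoints C) (hQ : Q ⊆ isolatedPoints C) {z : C}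
    (hPz : ∀ V ∈ 𝓝 z, (P \ V).Finite) (hQz : ∀ V ∈ 𝓝 z, (Q \ V).Finite) {h : C → C}
    (hinj : Function.Injective h) (hhP : MapsTo h P Q) (hhQ : MapsTo h Q P)
    (hfix : ∀ x, x ∉ P → x ∉ Q → h x = x) : Continuous h := by
  refine continuous_iff_continuousAt.2 fun y => ?_
  by_cases hy : y ∈ isolatedPoints C
  · rw [ContinuousAt, (isOpen_singleton_iff_nhds_eq_pure y).1 hy]
    exact tendsto_pure_nhds h y
  have hyP : y ∉ P := fun h => hy (hP h)
  have hyQ : y ∉ Q := fun h => hy (hQ h)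
  intro V hV
  rw [hfix y hyP hyQ] at hV
  suffices hW : ∃ W ∈ 𝓝 y, (((P ∪ Q) ∩ W) \ (h ⁻¹' V)).Finite by
    obtain ⟨W, hW, hfin⟩ := hW
    refine mem_map.2 <| mem_of_superset (inter_mem (inter_mem hV hW)
      (hfin.isClosed.isOpen_compl.mem_nhds fun hmem => hmem.1.1.elim hyP hyQ)) ?_
    rintro x ⟨⟨hxV, hxW⟩, hx⟩
    by_contra hxh
    by_cases hxPQ : x ∈ P ∪ Q
    · exact hx ⟨⟨hxPQ, hxW⟩, hxh⟩
    · rw [mem_union, not_or] at hxPQ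
      exact hxh (by rwa [mem_preimage, hfix x hxPQ.1 hxPQ.2])
  by_cases hyz : y = z
  · subst hyz
    refine ⟨univ, univ_mem, (((hPz V hV).union (hQz V hV)).preimage hinj.injOn).subset ?_⟩
    rintro x ⟨⟨hx | hx, -⟩, hxV⟩
    · exact Or.inr ⟨hhP hx, hxV⟩
    · exact Or.inl ⟨hhQ hx, hxV⟩
  · obtain ⟨W, W', hW, hW', hdisj⟩ := t2_separation_nhds hyz
    refine ⟨W, hW, ((hPz W' hW').union (hQz W' hW')).subset ?_⟩
    rintro x ⟨⟨hx | hx, hxW⟩, -⟩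
    · exact Or.inl ⟨hx, disjoint_left.1 hdisj hxW⟩
    · exact Or.inr ⟨hx, disjoint_left.1 hdisj hxW⟩

/-- Every compactification of a countable discrete space whose remainder has character `< 𝔭`
is soft. -/
theorem isSoft_of_spaceChar_remainder_lt {K C : Type u} [TopologicalSpace K]
    [TopologicalSpace C] [CompactSpace C] [T2Space C] (hinf : (isolatedPoints C).Infinite)
    (hcount : (isolatedPoints C).Countable) (e : K ≃ₜ ↥((isolatedPoints C)ᶜ))
    (hchar : spaceChar K < Cardinal.lift.{u} pCard) : IsSoft C := by
  rintro A B hAB ⟨z, hzA, hzB⟩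
  have hAB' : Disjoint (Subtype.val '' A) (Subtype.val '' B) :=
    (disjoint_image_iff Subtype.val_injective).2 hAB
  have hsub : ∀ D : Set ↥(isolatedPoints C), Subtype.val '' D ⊆ isolatedPoints C := by
    rintro D _ ⟨x, -, rfl⟩
    exact x.2
  have hz : z ∉ isolatedPoints C := by
    intro hz
    obtain ⟨_, rfl, ha⟩ := mem_closure_iff.1 hzA {z} hz rfl
    obtain ⟨_, rfl, hb⟩ := mem_closure_iff.1 hzB _ hz rfl
    exact disjoint_left.1 hAB' ha hb
  obtain ⟨P, hPA, hPinf, hPz⟩ :=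
    exists_infinite_subset_converging hinf hcount e hchar (hsub A) hz hzA
  obtain ⟨Q, hQB, hQinf, hQz⟩ :=
    exists_infinite_subset_converging hinf hcount e hchar (hsub B) hz hzB
  have hP := hPA.trans (hsub A)
  have hQ := hQB.trans (hsub B)
  obtain ⟨h, hinv, hhP, hhQ, hfix⟩ := exists_involutive_swap hPinf hQinf (hcount.mono hP)
    (hcount.mono hQ) (hAB'.mono hPA hQB)
  have hcont : Continuous h :=
    continuous_of_swap_converging hP hQ hPz hQz hinv.injective hhP hhQ hfix
  let g : C ≃ₜ C :=
    { toEquiv := hinv.toPerm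
      continuous_toFun := hcont
      continuous_invFun := hcont }
  have hiso : ∀ x, g x ∈ isolatedPoints C ↔ x ∈ isolatedPoints C := fun x => by
    simp only [isolatedPoints, mem_ofPred_eq, ← g.isOpen_image (s := {x}), image_singleton]
  refine ⟨Equiv.Perm.subtypePerm g.toEquiv hiso, ⟨g, fun x hx => ?_, fun x => rfl⟩, ?_⟩
  · exact hfix x (fun h => hx (hP h)) (fun h => hx (hQ h))
  · refine Infinite.of_image Subtype.val (hPinf.mono fun x hx => ?_)
    obtain ⟨a, ha, rfl⟩ := hPA hx
    refine ⟨a, ⟨ha, ?_⟩, rfl⟩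
    obtain ⟨b, hb, hbx⟩ := hQB (hhP hx)
    convert hb
    exact Subtype.ext hbx.symm

/-- Every compact Hausdorff space which is a corona of character `< 𝔭`
is a soft corona. -/
theorem statement18 (K : Type u) [TopologicalSpace K]
    (hcor : IsCorona K) (hchar : spaceChar K < Cardinal.lift.{u} pCard) :
    IsSoftCorona K := by
  obtain ⟨hK, hK2, C, _, hC, hinf, hcount, ⟨e⟩⟩ := hcor
  have := hC.1
  have := hC.2.1
  exact ⟨hK, hK2, C, _, hC, isSoft_of_spaceChar_remainder_lt hinf hcount e hchar, hinf, hcount, ⟨e⟩⟩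
end
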